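/- Let β ∈ (0,1) and α > 1/4. Then there exists a constant C = C(β, α) such that for all N ∈ ℕ and all h with 0 ≤ h ≤ N^{−α}: E_{W ~ GOE(N)}[ Z(W)² · ( m_W(h) − q₁(β,h) )² ] ≤ C·( E_{W ~ GOE(N)}[Z(W)] )² · ( max{1/N, h/√N} )², where Z(W) = Σ_{σ ∈ {±1}^N} exp( (β/2)·σᵀWσ + h·⟨σ,𝟏⟩ ) is the partition function and m_W(h) = (1/N)·Σ_{i=1}^N E_{σ ~ μ_{βW,h𝟏}}[σ_i]. -/

import Mathlib

open MeasureTheory ProbabilityTheory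

noncomputable section

/-- Standard Gaussian measure on `ℝ`. -/
def stdGaussian : Measure ℝ := gaussianReal 0 1

/-- The overlap constant `q_{β,h}`, the unique solution in `(0,1]` of the replica-symmetric
fixed point equation (set to `0` for `h = 0`). -/
def qOverlap (β h : ℝ) : ℝ :=
  if h = 0 then 0 else
    sSup {q : ℝ | q ∈ Set.Ioc (0 : ℝ) 1 ∧
      q = ∫ g, Real.tanh (β * g * Real.sqrt q + h) ^ 2 ∂stdGaussian}

/-- `q₁(β,h) = E tanh(β g √q_{β,h} + h)`. -/
def q1 (β h : ℝ) : ℝ :=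
  ∫ g, Real.tanh (β * g * Real.sqrt (qOverlap β h) + h) ∂stdGaussian

/-- Hyperbolic secant. -/
def sech (x : ℝ) : ℝ := 1 / Real.cosh x

/-- The Almeida–Thouless condition for `(β,h)`. -/
def ATCond (β h : ℝ) : Prop :=
  β ^ 2 * ∫ g, sech (β * g * Real.sqrt (qOverlap β h) + h) ^ 4 ∂stdGaussian < 1

/-- The AT condition with gap at least `g0`. -/
def ATgap (β h g0 : ℝ) : Prop :=
  β ^ 2 * ∫ g, sech (β * g * Real.sqrt (qOverlap β h) + h) ^ 4 ∂stdGaussian ≤ 1 - g0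

/-- The one-dimensional RGD/AMP update map `f_{β,λ}`. -/
def fbl (β lam z : ℝ) : ℝ :=
  ∫ g, Real.tanh (β * g * Real.sqrt (qOverlap β (β * lam * z)) + β * lam * z) ∂stdGaussian

/-- `h_* = inf{h ≥ 0 : (β,h) satisfies AT}`. -/
def hStar (β : ℝ) : ℝ := sInf {h : ℝ | 0 ≤ h ∧ ATCond β h}

/-- The spin value of a Boolean. -/
def spin (b : Bool) : ℝ := if b then 1 else -1

/-- Normalized correlation `R(σ,ρ) = ⟨σ,ρ⟩/N`. -/
def overlap {N : ℕ} (σ ρ : Fin N → Bool) : ℝ := (∑ i, spin (σ i) * spin (ρ i)) / N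

/-- The all-ones configuration `𝟏`. -/
def onesConf (N : ℕ) : Fin N → Bool := fun _ => true

/-- Unnormalized SK Gibbs weight with interaction `β W` and external field `h 𝟏`. -/
def skWeight {N : ℕ} (W : Matrix (Fin N) (Fin N) ℝ) (β h : ℝ) (σ : Fin N → Bool) : ℝ :=
  Real.exp (β / 2 * (∑ i, ∑ j, W i j * spin (σ i) * spin (σ j)) + h * ∑ i, spin (σ i))

/-- SK partition function. -/
def skZ {N : ℕ} (W : Matrix (Fin N) (Fin N) ℝ) (β h : ℝ) : ℝ :=
  ∑ σ : Fin N → Bool, skWeight W β h σ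

/-- Normalized SK Gibbs density. -/
def skDensity {N : ℕ} (W : Matrix (Fin N) (Fin N) ℝ) (β h : ℝ) (σ : Fin N → Bool) : ℝ :=
  skWeight W β h σ / skZ W β h

/-- The SK Gibbs measure `μ_{βW, h𝟏}` on `{±1}^N`. -/
def skGibbs {N : ℕ} (W : Matrix (Fin N) (Fin N) ℝ) (β h : ℝ) : Measure (Fin N → Bool) :=
  ∑ σ : Fin N → Bool, ENNReal.ofReal (skDensity W β h σ) • Measure.dirac σ

instance matrixMeasurableSpace {N : ℕ} : MeasurableSpace (Matrix (Fin N) (Fin N) ℝ) :=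
  (inferInstance : MeasurableSpace (Fin N → Fin N → ℝ))

/-- The GOE(N) random matrix ensemble. -/
def GOE (N : ℕ) : Measure (Matrix (Fin N) (Fin N) ℝ) :=
  (Measure.pi fun p : Fin N × Fin N =>
      if p.1 = p.2 then gaussianReal 0 (2 / N) else gaussianReal 0 (1 / N)).map
    (fun W => Matrix.of fun i j => if i ≤ j then W (i, j) else W (j, i))

/-- The mean magnetization `m_W(h) = (1/N) Σᵢ E_{σ ~ μ_{βW,h𝟏}}[σᵢ]`. -/
def meanMag {N : ℕ} (W : Matrix (Fin N) (Fin N) ℝ) (β h : ℝ) : ℝ :=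
  (1 / (N : ℝ)) * ∑ i : Fin N, ∫ σ, spin (σ i) ∂skGibbs W β h


/-! ### Elementary inequalities -/

lemma aux_sinh_le {x : ℝ} (hx : 0 ≤ x) : Real.sinh x ≤ x * Real.cosh x := by
  have hmono : MonotoneOn (fun y : ℝ => y * Real.cosh y - Real.sinh y) (Set.Ici 0) := by
    apply monotoneOn_of_deriv_nonneg (convex_Ici 0)
    · exact (by fun_prop : Continuous fun y : ℝ => y * Real.cosh y - Real.sinh y).continuousOn
    · exact (by fun_prop : Differentiable ℝ
        fun y : ℝ => y * Real.cosh y - Real.sinh y).differentiableOn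
    · intro y hy
      simp only [interior_Ici, Set.mem_Ioi] at hy
      have h1 : HasDerivAt (fun y : ℝ => y * Real.cosh y - Real.sinh y)
          (1 * Real.cosh y + y * Real.sinh y - Real.cosh y) y :=
        ((hasDerivAt_id y).mul (Real.hasDerivAt_cosh y)).sub (Real.hasDerivAt_sinh y)
      rw [h1.deriv]
      have := mul_nonneg hy.le (Real.sinh_nonneg_iff.2 hy.le)
      linarith
  have := hmono (Set.mem_Ici.2 le_rfl) (Set.mem_Ici.2 hx) hx
  simp at this
  linarith

lemma aux_abs_sinh_le (x : ℝ) : |Real.sinh x| ≤ |x| * Real.cosh x := by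
  rw [Real.abs_sinh, ← Real.cosh_abs x]
  exact aux_sinh_le (abs_nonneg x)

lemma aux_tanh_nonneg {x : ℝ} (hx : 0 ≤ x) : 0 ≤ Real.tanh x := by
  rw [Real.tanh_eq_sinh_div_cosh]
  exact div_nonneg (Real.sinh_nonneg_iff.2 hx) (Real.cosh_pos x).le

lemma aux_tanh_le {x : ℝ} (hx : 0 ≤ x) : Real.tanh x ≤ x := by
  rw [Real.tanh_eq_sinh_div_cosh, div_le_iff₀ (Real.cosh_pos x)]
  exact aux_sinh_le hx

lemma aux_abs_tanh_le (x : ℝ) : |Real.tanh x| ≤ |x| := by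
  rw [Real.tanh_eq_sinh_div_cosh, abs_div, abs_of_pos (Real.cosh_pos x),
    div_le_iff₀ (Real.cosh_pos x)]
  exact aux_abs_sinh_le x

lemma aux_sub_tanh_le {x : ℝ} (hx : 0 ≤ x) : x - Real.tanh x ≤ x ^ 3 := by
  have hc := Real.cosh_pos x
  have h1 : x ≤ Real.sinh x := Real.self_le_sinh_iff.2 hx
  have h2 : Real.cosh x - 1 ≤ x ^ 2 * Real.cosh x := by
    have e1 : Real.cosh x = Real.cosh (x / 2) ^ 2 + Real.sinh (x / 2) ^ 2 := by
      rw [← Real.cosh_two_mul]; congr 1; ring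
    have e2 := Real.cosh_sq (x / 2)
    have e3 := aux_sinh_le (x := x / 2) (by linarith)
    have e4 : 0 ≤ Real.sinh (x / 2) := Real.sinh_nonneg_iff.2 (by linarith)
    have e5 : Real.sinh (x / 2) ^ 2 ≤ (x / 2 * Real.cosh (x / 2)) ^ 2 :=
      pow_le_pow_left₀ e4 e3 2
    nlinarith [mul_nonneg (sq_nonneg x) (sq_nonneg (Real.sinh (x / 2))),
      mul_nonneg (sq_nonneg x) (sq_nonneg (Real.cosh (x / 2)))]
  have h3 : x - x ^ 3 ≤ Real.tanh x := by
    rw [Real.tanh_eq_sinh_div_cosh, le_div_iff₀ hc]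
    nlinarith
  linarith

lemma aux_abs_tanh_sub_le (x : ℝ) : |Real.tanh x - x| ≤ |x| ^ 3 := by
  have key : ∀ y : ℝ, 0 ≤ y → |Real.tanh y - y| ≤ y ^ 3 := by
    intro y hy
    rw [abs_sub_comm, abs_of_nonneg (by linarith [aux_tanh_le hy])]
    exact aux_sub_tanh_le hy
  rcases le_total 0 x with hx | hx
  · rw [abs_of_nonneg hx]; exact key x hx
  · have := key (-x) (by linarith)
    rw [Real.tanh_neg] at this
    rw [abs_of_nonpos hx, ← abs_neg]
    convert this using 2
    ring

lemma aux_measurable_tanh : Measurable Real.tanh := by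
  have : Real.tanh = fun x => Real.sinh x / Real.cosh x := by
    funext x; exact Real.tanh_eq_sinh_div_cosh x
  rw [this]
  exact Real.measurable_sinh.div Real.measurable_cosh

lemma aux_abs_tanh_le_one (x : ℝ) : |Real.tanh x| ≤ 1 := by
  rw [Real.tanh_eq_sinh_div_cosh, abs_div, abs_of_pos (Real.cosh_pos x),
    div_le_one (Real.cosh_pos x), abs_le]
  constructor
  · have := Real.exp_pos x
    rw [← Real.cosh_add_sinh] at this; linarith
  · exact (Real.sinh_lt_cosh x).le

/-! ### Gaussian facts and the bound on `q₁` -/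

instance : IsProbabilityMeasure _root_.stdGaussian := by unfold _root_.stdGaussian; infer_instance

lemma aux_integrable_pow (k : ℕ) : Integrable (fun g : ℝ => |g| ^ k) _root_.stdGaussian := by
  have h := (memLp_id_gaussianReal (μ := 0) (v := 1) (k : NNReal)).integrable_norm_pow' 
  simpa [_root_.stdGaussian] using h

lemma aux_integral_id : ∫ g, g ∂_root_.stdGaussian = 0 := by
  simp [_root_.stdGaussian]

lemma aux_integrable_id : Integrable (fun g : ℝ => g) _root_.stdGaussian := by
  exact (memLp_id_gaussianReal (μ := 0) (v := 1) 1).integrable le_rfl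

lemma aux_integrable_sq : Integrable (fun g : ℝ => g ^ 2) _root_.stdGaussian := by
  simpa using aux_integrable_pow 2

lemma aux_integral_sq : ∫ g, g ^ 2 ∂_root_.stdGaussian = 1 := by
  have h := variance_id_gaussianReal (μ := 0) (v := 1)
  rw [variance_eq_integral (by fun_prop)] at h
  simpa [_root_.stdGaussian] using h

lemma aux_integrable_exp_sq {a : ℝ} (ha : a < 1 / 2) :
    Integrable (fun g : ℝ => Real.exp (a * g ^ 2)) _root_.stdGaussian := by
  unfold _root_.stdGaussian
  rw [gaussianReal_of_var_ne_zero 0 one_ne_zero, gaussianPDF_def]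
  rw [integrable_withDensity_iff_integrable_smul' (by fun_prop) (by simp)]
  have h := (integrable_exp_neg_mul_sq (b := 1 / 2 - a) (by linarith)).const_mul
    ((Real.sqrt (2 * Real.pi))⁻¹)
  refine h.congr (Filter.Eventually.of_forall fun x => ?_)
  simp only [smul_eq_mul]
  rw [ENNReal.toReal_ofReal (gaussianPDFReal_nonneg _ _ _), gaussianPDFReal]
  simp only [NNReal.coe_one, mul_one, sub_zero]
  rw [mul_assoc, ← Real.exp_add]
  congr 2
  ring

/-- The dominating function. -/
def auxE (β g : ℝ) : ℝ := Real.exp (β ^ 2 * g ^ 2 / 2 + |g|)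

lemma aux_integrable_E {β : ℝ} (hβ0 : 0 < β) (hβ1 : β < 1) (a b : ℝ) :
    Integrable (fun g : ℝ => auxE β g * (a + b * g ^ 2)) _root_.stdGaussian := by
  have hb2 : β ^ 2 < 1 := by nlinarith
  set ε := (1 - β ^ 2) / 4 with hε
  have hεpos : 0 < ε := by rw [hε]; linarith
  have h0 := (aux_integrable_exp_sq (a := β ^ 2 / 2 + ε) (by rw [hε]; linarith)).const_mul
    ((|a| + 2 * |b|) * Real.exp (1 / ε))
  refine h0.mono' ?_ (Filter.Eventually.of_forall fun g => ?_)
  · unfold auxE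
    exact (by fun_prop : Continuous fun g : ℝ => Real.exp (β ^ 2 * g ^ 2 / 2 + |g|) *
      (a + b * g ^ 2)).aestronglyMeasurable
  · have hq : g ^ 2 ≤ 2 * Real.exp |g| := by
      have := Real.quadratic_le_exp_of_nonneg (abs_nonneg g)
      rw [sq_abs] at this
      nlinarith [abs_nonneg g]
    have h1 : (1 : ℝ) ≤ Real.exp |g| := Real.one_le_exp (abs_nonneg g)
    have h2 : |a + b * g ^ 2| ≤ (|a| + 2 * |b|) * Real.exp |g| := by
      calc |a + b * g ^ 2| ≤ |a| + |b * g ^ 2| := abs_add_le _ _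
        _ = |a| + |b| * g ^ 2 := by rw [abs_mul, abs_of_nonneg (sq_nonneg g)]
        _ ≤ |a| * Real.exp |g| + |b| * (2 * Real.exp |g|) := by
            gcongr
            exact le_mul_of_one_le_right (abs_nonneg a) h1
        _ = _ := by ring
    have h3 : 2 * |g| ≤ ε * g ^ 2 + 1 / ε := by
      have : 0 ≤ (ε * |g| - 1) ^ 2 / ε := by positivity
      have e : (ε * |g| - 1) ^ 2 / ε = ε * g ^ 2 + 1 / ε - 2 * |g| := by
        rw [← sq_abs g]; field_simp; ring
      linarith
    rw [Real.norm_eq_abs, abs_mul, auxE, abs_of_pos (Real.exp_pos _)]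
    calc Real.exp (β ^ 2 * g ^ 2 / 2 + |g|) * |a + b * g ^ 2|
        ≤ Real.exp (β ^ 2 * g ^ 2 / 2 + |g|) * ((|a| + 2 * |b|) * Real.exp |g|) := by gcongr
      _ = (|a| + 2 * |b|) * Real.exp (β ^ 2 * g ^ 2 / 2 + 2 * |g|) := by
          rw [show β ^ 2 * g ^ 2 / 2 + 2 * |g| = β ^ 2 * g ^ 2 / 2 + |g| + |g| by ring,
            Real.exp_add (β ^ 2 * g ^ 2 / 2 + |g|) |g|]; ring
      _ ≤ (|a| + 2 * |b|) * Real.exp (1 / ε + (β ^ 2 / 2 + ε) * g ^ 2) := by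
          refine mul_le_mul_of_nonneg_left (Real.exp_le_exp.2 ?_) (by positivity)
          linarith
      _ = _ := by rw [Real.exp_add]; ring

lemma aux_qOverlap_nonneg (β h : ℝ) : 0 ≤ qOverlap β h := by
  unfold qOverlap
  split_ifs
  · exact le_rfl
  · exact Real.sSup_nonneg fun q hq => hq.1.1.le

lemma aux_qOverlap_le {β h : ℝ} (hβ0 : 0 < β) (hβ1 : β < 1) :
    qOverlap β h ≤ h ^ 2 / (1 - β ^ 2) := by
  have hb2 : 0 < 1 - β ^ 2 := by nlinarith
  unfold qOverlap
  split_ifs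
  · positivity
  · refine Real.sSup_le ?_ (by positivity)
    rintro q ⟨⟨hq0, -⟩, hq⟩
    have e : ∀ g : ℝ, (β * g * Real.sqrt q + h) ^ 2
        = (β ^ 2 * q) * g ^ 2 + (2 * β * Real.sqrt q * h) * g + h ^ 2 := by
      intro g
      have := Real.sq_sqrt hq0.le
      linear_combination (β ^ 2 * g ^ 2) * this
    have i1 := aux_integrable_sq.const_mul (β ^ 2 * q)
    have i2 := aux_integrable_id.const_mul (2 * β * Real.sqrt q * h)
    have i3 : Integrable (fun _ : ℝ => h ^ 2) _root_.stdGaussian := integrable_const _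
    have hint : Integrable (fun g : ℝ => (β * g * Real.sqrt q + h) ^ 2) _root_.stdGaussian := by
      simp_rw [e]
      exact (i1.add i2).add i3
    have hval : ∫ g, (β * g * Real.sqrt q + h) ^ 2 ∂_root_.stdGaussian = β ^ 2 * q + h ^ 2 := by
      simp_rw [e]
      have i12 : Integrable (fun g : ℝ => β ^ 2 * q * g ^ 2 + 2 * β * Real.sqrt q * h * g)
        _root_.stdGaussian := i1.add i2
      rw [integral_add i12 i3, integral_add i1 i2, integral_const_mul,
        integral_const_mul, aux_integral_id, aux_integral_sq]
      simp
    have hle : ∫ g, Real.tanh (β * g * Real.sqrt q + h) ^ 2 ∂_root_.stdGaussian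
        ≤ ∫ g, (β * g * Real.sqrt q + h) ^ 2 ∂_root_.stdGaussian := by
      refine integral_mono_of_nonneg (Filter.Eventually.of_forall fun g => sq_nonneg _) hint
        (Filter.Eventually.of_forall fun g => ?_)
      exact sq_le_sq.2 (aux_abs_tanh_le _)
    rw [← hq, hval] at hle
    rw [le_div_iff₀ hb2]
    linarith

lemma aux_q1_bound {β : ℝ} (hβ0 : 0 < β) (hβ1 : β < 1) :
    ∃ C : ℝ, 0 < C ∧ ∀ h : ℝ, 0 ≤ h → |q1 β h - Real.tanh h| ≤ C * h ^ 3 := by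
  have hb2 : 0 < 1 - β ^ 2 := by nlinarith
  set b : ℝ := Real.sqrt (1 / (1 - β ^ 2)) with hb
  have hbnn : 0 ≤ b := Real.sqrt_nonneg _
  have e3 : ∀ g : ℝ, (b * |g| + 1) ^ 3
      = b ^ 3 * |g| ^ 3 + 3 * b ^ 2 * |g| ^ 2 + 3 * b * |g| ^ 1 + 1 := by
    intro g; ring
  have hint : Integrable (fun g : ℝ => (b * |g| + 1) ^ 3) _root_.stdGaussian := by
    simp_rw [e3]
    exact ((((aux_integrable_pow 3).const_mul _).add ((aux_integrable_pow 2).const_mul _)).add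
      ((aux_integrable_pow 1).const_mul _)).add (integrable_const _)
  set M := ∫ g, (b * |g| + 1) ^ 3 ∂_root_.stdGaussian with hM
  have hMnn : 0 ≤ M := integral_nonneg fun g => by positivity
  refine ⟨M + 1, by linarith, fun h hh => ?_⟩
  set s := Real.sqrt (qOverlap β h) with hs
  have hsnn : 0 ≤ s := Real.sqrt_nonneg _
  have hsle : s ≤ b * h := by
    have h1 : s ≤ Real.sqrt (h ^ 2 / (1 - β ^ 2)) := Real.sqrt_le_sqrt (aux_qOverlap_le hβ0 hβ1)
    have h2 : Real.sqrt (h ^ 2 / (1 - β ^ 2)) = b * h := by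
      rw [hb, div_eq_mul_one_div, Real.sqrt_mul (sq_nonneg h), Real.sqrt_sq hh, mul_comm]
    linarith
  have hit : Integrable (fun g : ℝ => Real.tanh (β * g * s + h)) _root_.stdGaussian := by
    refine (integrable_const (1 : ℝ)).mono' ?_ (Filter.Eventually.of_forall fun g => ?_)
    · exact (aux_measurable_tanh.comp (by fun_prop)).aestronglyMeasurable
    · exact aux_abs_tanh_le_one _
  have hil : Integrable (fun g : ℝ => β * g * s + h) _root_.stdGaussian :=
    ((aux_integrable_id.const_mul β).mul_const s).add (integrable_const _)
  have hlv : ∫ g, (β * g * s + h) ∂_root_.stdGaussian = h := by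
    rw [integral_add ((aux_integrable_id.const_mul β).mul_const s) (integrable_const _),
      integral_mul_const, integral_const_mul, aux_integral_id]
    simp
  have hmain : |q1 β h - h| ≤ M * h ^ 3 := by
    have h1 : q1 β h - h = ∫ g, (Real.tanh (β * g * s + h) - (β * g * s + h)) ∂_root_.stdGaussian := by
      rw [integral_sub hit hil, hlv]; rfl
    rw [h1]
    calc |∫ g, (Real.tanh (β * g * s + h) - (β * g * s + h)) ∂_root_.stdGaussian|
        ≤ ∫ g, |Real.tanh (β * g * s + h) - (β * g * s + h)| ∂_root_.stdGaussian :=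
          abs_integral_le_integral_abs
      _ ≤ ∫ g, (b * |g| + 1) ^ 3 * h ^ 3 ∂_root_.stdGaussian := by
          refine integral_mono (hit.sub hil).abs (hint.mul_const _) fun g => ?_
          refine (aux_abs_tanh_sub_le _).trans ?_
          rw [← mul_pow]
          refine pow_le_pow_left₀ (abs_nonneg _) ?_ 3
          calc |β * g * s + h| ≤ |β * g * s| + |h| := abs_add_le _ _
            _ = β * (|g| * s) + h := by
              rw [abs_mul, abs_mul, abs_of_pos hβ0, abs_of_nonneg hsnn, abs_of_nonneg hh]; ring
            _ ≤ 1 * (|g| * (b * h)) + h := by gcongr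
            _ = (b * |g| + 1) * h := by ring
      _ = M * h ^ 3 := by rw [integral_mul_const]
  have h2 : |h - Real.tanh h| ≤ h ^ 3 := by
    have := aux_abs_tanh_sub_le h
    rwa [abs_sub_comm, abs_of_nonneg hh] at this
  calc |q1 β h - Real.tanh h| ≤ |q1 β h - h| + |h - Real.tanh h| := abs_sub_le _ _ _
    _ ≤ M * h ^ 3 + h ^ 3 := by gcongr
    _ = (M + 1) * h ^ 3 := by ring

/-! ### GOE exponential moments -/

/-- Multiplicity of the pair `p` in the quadratic form. -/
def auxM {N : ℕ} (p : Fin N × Fin N) : ℝ := if p.1 = p.2 then 1 else if p.1 < p.2 then 2 else 0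

lemma auxM_add_swap {N : ℕ} (i j : Fin N) : auxM (i, j) + auxM (j, i) = 2 := by
  unfold auxM
  rcases lt_trichotomy i j with h | h | h
  · simp [h.ne, h.ne', h, h.not_gt]; 
  · simp [h]; norm_num
  · simp [h.ne, h.ne', h, h.not_gt]; 

lemma aux_sym_sum {N : ℕ} (F : Fin N → Fin N → ℝ) (hF : ∀ i j, F i j = F j i) :
    ∑ p : Fin N × Fin N, auxM p * F p.1 p.2 = ∑ i, ∑ j, F i j := by
  rw [Fintype.sum_prod_type]
  have h1 : ∑ i : Fin N, ∑ j : Fin N, auxM (i, j) * F i j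
      = ∑ i : Fin N, ∑ j : Fin N, auxM (j, i) * F i j := by
    rw [Finset.sum_comm]
    refine Finset.sum_congr rfl fun i _ => Finset.sum_congr rfl fun j _ => ?_
    rw [hF j i]
  have h2 : ∑ i : Fin N, ∑ j : Fin N, auxM (i, j) * F i j
      + ∑ i : Fin N, ∑ j : Fin N, auxM (j, i) * F i j = 2 * ∑ i, ∑ j, F i j := by
    rw [← Finset.sum_add_distrib, Finset.mul_sum]
    refine Finset.sum_congr rfl fun i _ => ?_
    rw [← Finset.sum_add_distrib, Finset.mul_sum]
    refine Finset.sum_congr rfl fun j _ => ?_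
    rw [← add_mul, auxM_add_swap]
  simp only
  linarith

/-- The base measure of the GOE. -/
def auxPi (N : ℕ) (p : Fin N × Fin N) : Measure ℝ :=
  if p.1 = p.2 then gaussianReal 0 (2 / N) else gaussianReal 0 (1 / N)

/-- Variances. -/
def auxV (N : ℕ) (p : Fin N × Fin N) : NNReal := if p.1 = p.2 then 2 / N else 1 / N

lemma auxPi_eq (N : ℕ) (p : Fin N × Fin N) : auxPi N p = gaussianReal 0 (auxV N p) := by
  unfold auxPi auxV; split_ifs <;> rfl

instance (N : ℕ) (p : Fin N × Fin N) : IsProbabilityMeasure (auxPi N p) := by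
  rw [auxPi_eq]; infer_instance

/-- Symmetrization map. -/
def auxSym (N : ℕ) (W : Fin N × Fin N → ℝ) : Matrix (Fin N) (Fin N) ℝ :=
  Matrix.of fun i j => if i ≤ j then W (i, j) else W (j, i)

lemma GOE_eq (N : ℕ) : GOE N = (Measure.pi (auxPi N)).map (auxSym N) := rfl

lemma aux_measurable_sym (N : ℕ) : Measurable (auxSym N) := by
  have : Measurable (fun (W : Fin N × Fin N → ℝ) (i j : Fin N) =>
      if i ≤ j then W (i, j) else W (j, i)) := by
    refine measurable_pi_lambda _ fun i => measurable_pi_lambda _ fun j => ?_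
    split_ifs <;> fun_prop
  exact this

lemma aux_measurable_entry {N : ℕ} (i j : Fin N) :
    Measurable (fun W : Matrix (Fin N) (Fin N) ℝ => W i j) := by
  have : Measurable (fun W : Fin N → Fin N → ℝ => W i j) := by fun_prop
  exact this

/-- Exponential of a quadratic form. -/
def auxQ {N : ℕ} (β : ℝ) (u : Fin N → Fin N → ℝ) (W : Matrix (Fin N) (Fin N) ℝ) : ℝ :=
  Real.exp (β / 2 * ∑ i, ∑ j, W i j * u i j)

lemma aux_measurable_Q {N : ℕ} (β : ℝ) (u : Fin N → Fin N → ℝ) : Measurable (auxQ β u) := by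
  unfold auxQ
  refine Real.measurable_exp.comp (Measurable.const_mul ?_ _)
  refine Finset.measurable_sum _ fun i _ => Finset.measurable_sum _ fun j _ => ?_
  exact (aux_measurable_entry i j).mul_const _

lemma auxQ_sym {N : ℕ} (β : ℝ) (u : Fin N → Fin N → ℝ) (hu : ∀ i j, u i j = u j i)
    (W : Fin N × Fin N → ℝ) :
    auxQ β u (auxSym N W) = ∏ p, Real.exp ((β / 2 * auxM p * u p.1 p.2) * W p) := by
  unfold auxQ
  rw [← Real.exp_sum, ← aux_sym_sum (fun i j => auxSym N W i j * u i j), Finset.mul_sum]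
  · congr 1
    refine Finset.sum_congr rfl fun p _ => ?_
    obtain ⟨i, j⟩ := p
    simp only [auxSym, Matrix.of_apply, auxM]
    rcases lt_trichotomy i j with h | h | h
    · simp [h.ne, h, h.le]; ring
    · simp [h]; ring
    · simp [h.ne', h.not_gt]
  · intro i j
    simp only [auxSym, Matrix.of_apply]
    rw [hu i j]
    rcases lt_trichotomy i j with h | h | h
    · simp [h.le, h.not_ge]
    · simp [h]
    · simp [h.le, h.not_ge]

lemma aux_integrable_Q {N : ℕ} (β : ℝ) (u : Fin N → Fin N → ℝ) (hu : ∀ i j, u i j = u j i) :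
    Integrable (auxQ β u) (GOE N) := by
  rw [GOE_eq, integrable_map_measure (aux_measurable_Q β u).aestronglyMeasurable
    (aux_measurable_sym N).aemeasurable]
  have : auxQ β u ∘ auxSym N = fun W => ∏ p, Real.exp ((β / 2 * auxM p * u p.1 p.2) * W p) := by
    funext W; exact auxQ_sym β u hu W
  rw [this]
  refine Integrable.fintype_prod (f := fun p x => Real.exp ((β / 2 * auxM p * u p.1 p.2) * x))
    fun p => ?_
  rw [auxPi_eq]
  exact integrable_exp_mul_gaussianReal _

lemma aux_integral_exp (v : NNReal) (c : ℝ) :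
    ∫ x, Real.exp (c * x) ∂(gaussianReal 0 v) = Real.exp (v * c ^ 2 / 2) := by
  have h := mgf_gaussianReal (p := gaussianReal 0 v) (X := id) (μ := 0) (v := v)
    (by simp) c
  simpa [mgf] using h

lemma aux_integral_Q {N : ℕ} (β : ℝ) (u : Fin N → Fin N → ℝ) (hu : ∀ i j, u i j = u j i) :
    ∫ W, auxQ β u W ∂GOE N = Real.exp (β ^ 2 / (4 * N) * ∑ i, ∑ j, u i j ^ 2) := by
  rw [GOE_eq, integral_map (aux_measurable_sym N).aemeasurable
    (aux_measurable_Q β u).aestronglyMeasurable]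
  simp_rw [auxQ_sym β u hu]
  rw [integral_fintype_prod_eq_prod
    (f := fun p x => Real.exp ((β / 2 * auxM p * u p.1 p.2) * x))]
  simp_rw [auxPi_eq, aux_integral_exp]
  rw [← Real.exp_sum, ← aux_sym_sum (fun i j => u i j ^ 2) (fun i j => by rw [hu i j]),
    Finset.mul_sum]
  congr 1
  refine Finset.sum_congr rfl fun p _ => ?_
  obtain ⟨i, j⟩ := p
  simp only [auxV, auxM]
  rcases lt_trichotomy i j with h | h | h
  · simp [h.ne, h]; ring
  · simp [h]; ring
  · simp [h.ne', h.not_gt]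

/-! ### Combinatorial factorization -/

lemma aux_sum_cons {N : ℕ} {B : Type*} [Fintype B] (F : (Fin (N + 1) → B) → ℝ) :
    ∑ τ, F τ = ∑ b : B, ∑ τ : Fin N → B, F (Fin.cons b τ) := by
  rw [← (Fin.consEquiv (fun _ : Fin (N + 1) => B)).sum_comp, Fintype.sum_prod_type]
  rfl

lemma aux_S0 {B : Type*} [Fintype B] (φ : B → ℝ) (N : ℕ) :
    ∑ τ : Fin N → B, ∏ i, φ (τ i) = (∑ b, φ b) ^ N := by
  induction N with
  | zero => simp
  | succ N ih =>
    rw [aux_sum_cons]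
    simp only [Fin.prod_univ_succ, Fin.cons_zero, Fin.cons_succ]
    simp_rw [← Finset.mul_sum, ih]
    rw [← Finset.sum_mul, pow_succ, mul_comm]

lemma aux_S1 {B : Type*} [Fintype B] (φ f : B → ℝ) (N : ℕ) :
    ∑ τ : Fin N → B, (∏ i, φ (τ i)) * ∑ i, f (τ i)
      = N * (∑ b, φ b) ^ (N - 1) * ∑ b, φ b * f b := by
  induction N with
  | zero => simp
  | succ N ih =>
    rw [aux_sum_cons]
    simp only [Fin.prod_univ_succ, Fin.sum_univ_succ, Fin.cons_zero, Fin.cons_succ]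
    have e : ∀ (b : B) (τ : Fin N → B), φ b * (∏ i, φ (τ i)) * (f b + ∑ i, f (τ i))
        = (φ b * f b) * (∏ i, φ (τ i)) + φ b * ((∏ i, φ (τ i)) * ∑ i, f (τ i)) := by
      intro b τ; ring
    simp_rw [e, Finset.sum_add_distrib, ← Finset.mul_sum, ih, aux_S0, ← Finset.sum_mul]
    rcases N with _ | N
    · simp
    · simp only [Nat.add_sub_cancel]
      push_cast
      ring

lemma aux_S2 {B : Type*} [Fintype B] (φ f k : B → ℝ) (N : ℕ) :
    ∑ τ : Fin N → B, (∏ i, φ (τ i)) * ((∑ i, f (τ i)) * ∑ i, k (τ i))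
      = N * (∑ b, φ b) ^ (N - 1) * (∑ b, φ b * (f b * k b))
        + N * (N - 1) * (∑ b, φ b) ^ (N - 2) * ((∑ b, φ b * f b) * ∑ b, φ b * k b) := by
  induction N with
  | zero => simp
  | succ N ih =>
    rw [aux_sum_cons]
    simp only [Fin.prod_univ_succ, Fin.sum_univ_succ, Fin.cons_zero, Fin.cons_succ]
    have e : ∀ (b : B) (τ : Fin N → B), φ b * (∏ i, φ (τ i)) *
          ((f b + ∑ i, f (τ i)) * (k b + ∑ i, k (τ i)))
        = (φ b * (f b * k b)) * (∏ i, φ (τ i)) + (φ b * f b) * ((∏ i, φ (τ i)) * ∑ i, k (τ i))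
          + (φ b * k b) * ((∏ i, φ (τ i)) * ∑ i, f (τ i))
          + φ b * ((∏ i, φ (τ i)) * ((∑ i, f (τ i)) * ∑ i, k (τ i))) := by
      intro b τ; ring
    simp_rw [e, Finset.sum_add_distrib, ← Finset.mul_sum, ih, aux_S0, aux_S1, ← Finset.sum_mul]
    rcases N with _ | _ | N
    · simp
    · simp; ring
    · simp only [Nat.add_sub_cancel, show N + 1 + 1 - 1 = N + 1 from rfl,
        show N + 1 + 1 + 1 - 2 = N + 1 from rfl, show N + 1 + 1 - 2 = N from rfl]
      push_cast
      ring

/-- Biased spin weights. -/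
def auxP (t : ℝ) (b : Bool) : ℝ := (1 + t * spin b) / 2

lemma aux_exp_spin (h : ℝ) (b : Bool) :
    Real.exp (h * spin b) = 2 * Real.cosh h * auxP (Real.tanh h) b := by
  have hc := (Real.cosh_pos h).ne'
  have e : 2 * Real.cosh h * auxP (Real.tanh h) b = Real.cosh h + Real.sinh h * spin b := by
    rw [auxP, Real.tanh_eq_sinh_div_cosh]; field_simp
  rw [e]
  cases b
  · simp [spin]; rw [← Real.cosh_sub_sinh]; ring
  · simp [spin]

lemma aux_exp_sum_spin {N : ℕ} (h : ℝ) (σ : Fin N → Bool) :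
    Real.exp (h * ∑ i, spin (σ i)) = (2 * Real.cosh h) ^ N * ∏ i, auxP (Real.tanh h) (σ i) := by
  rw [Finset.mul_sum, Real.exp_sum]
  simp_rw [aux_exp_spin]
  rw [Finset.prod_mul_distrib]
  simp

lemma aux_exp_x_spin (x : ℝ) (a b : Bool) :
    Real.exp (x * (spin a * spin b)) = Real.cosh x + spin a * spin b * Real.sinh x := by
  cases a <;> cases b <;> simp [spin, ← Real.cosh_add_sinh]

/-- One-site partition function. -/
def auxK (t x : ℝ) : ℝ := Real.cosh x + t ^ 2 * Real.sinh x

/-- The conditional second moment given the Hubbard-Stratonovich field. -/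
def auxF (N : ℕ) (t c x : ℝ) : ℝ :=
  N * auxK t x ^ (N - 1) *
      ((1 - t ^ 2) * (1 - t ^ 2 - 2 * (c - t) * t) * Real.sinh x + (c - t) ^ 2 * auxK t x)
    + N * (N - 1) * auxK t x ^ (N - 2) *
      (t * (1 - t ^ 2) * Real.sinh x - (c - t) * auxK t x) ^ 2

lemma aux_pair_sum (N : ℕ) (t c x : ℝ) :
    ∑ σ : Fin N → Bool, ∑ ρ : Fin N → Bool,
      (∏ i, auxP t (σ i)) * (∏ i, auxP t (ρ i)) *
        ((∑ i, (spin (σ i) - c)) * ∑ i, (spin (ρ i) - c)) *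
        Real.exp (x * ∑ i, spin (σ i) * spin (ρ i)) = auxF N t c x := by
  have h := aux_S2 (B := Bool × Bool)
    (fun b => auxP t b.1 * auxP t b.2 * (Real.cosh x + spin b.1 * spin b.2 * Real.sinh x))
    (fun b => spin b.1 - c) (fun b => spin b.2 - c) N
  have h0 : ∑ b : Bool × Bool,
      auxP t b.1 * auxP t b.2 * (Real.cosh x + spin b.1 * spin b.2 * Real.sinh x)
      = auxK t x := by
    rw [Fintype.sum_prod_type]
    simp [auxP, spin, auxK, -Real.cosh_add_sinh, -Real.sinh_add_cosh, -Real.cosh_sub_sinh]; ring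
  have h1 : ∑ b : Bool × Bool,
      auxP t b.1 * auxP t b.2 * (Real.cosh x + spin b.1 * spin b.2 * Real.sinh x) *
        (spin b.1 - c) = t * (1 - t ^ 2) * Real.sinh x - (c - t) * auxK t x := by
    rw [Fintype.sum_prod_type]
    simp [auxP, spin, auxK, -Real.cosh_add_sinh, -Real.sinh_add_cosh, -Real.cosh_sub_sinh]; ring
  have h2 : ∑ b : Bool × Bool,
      auxP t b.1 * auxP t b.2 * (Real.cosh x + spin b.1 * spin b.2 * Real.sinh x) *
        (spin b.2 - c) = t * (1 - t ^ 2) * Real.sinh x - (c - t) * auxK t x := by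
    rw [Fintype.sum_prod_type]
    simp [auxP, spin, auxK, -Real.cosh_add_sinh, -Real.sinh_add_cosh, -Real.cosh_sub_sinh]; ring
  have h3 : ∑ b : Bool × Bool,
      auxP t b.1 * auxP t b.2 * (Real.cosh x + spin b.1 * spin b.2 * Real.sinh x) *
        ((spin b.1 - c) * (spin b.2 - c))
      = (1 - t ^ 2) * (1 - t ^ 2 - 2 * (c - t) * t) * Real.sinh x + (c - t) ^ 2 * auxK t x := by
    rw [Fintype.sum_prod_type]
    simp [auxP, spin, auxK, -Real.cosh_add_sinh, -Real.sinh_add_cosh, -Real.cosh_sub_sinh]; ring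
  rw [h0, h1, h2, h3] at h
  rw [auxF, sq (t * (1 - t ^ 2) * Real.sinh x - (c - t) * auxK t x), ← h,
    ← (Equiv.arrowProdEquivProdArrow (Fin N) (fun _ => Bool) (fun _ => Bool)).symm.sum_comp,
    Fintype.sum_prod_type]
  refine Finset.sum_congr rfl fun σ _ => Finset.sum_congr rfl fun ρ _ => ?_
  rw [Finset.mul_sum (f := fun i => spin (σ i) * spin (ρ i)), Real.exp_sum]
  simp only [Equiv.arrowProdEquivProdArrow, Equiv.coe_fn_symm_mk, Finset.prod_mul_distrib,
    aux_exp_x_spin]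
  ring

/-! ### Pointwise bound -/

lemma aux_sq_sub_le (a s d K : ℝ) :
    (a * s - d * K) ^ 2 ≤ 2 * (a ^ 2 * s ^ 2) + 2 * (d ^ 2 * K ^ 2) := by
  nlinarith [sq_nonneg (a * s + d * K)]

set_option maxHeartbeats 1000000 in
lemma aux_pointwise {β h c C1 g : ℝ} {N : ℕ} (hβ0 : 0 < β) (hβ1 : β < 1) (hN : 1 ≤ N)
    (hh0 : 0 ≤ h) (hh1 : h ≤ 1) (hhN : h ^ 2 * Real.sqrt N ≤ 1) (hC1 : 0 ≤ C1)
    (hc : |c - Real.tanh h| ≤ C1 * (h / Real.sqrt N)) :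
    auxF N (Real.tanh h) c (β / Real.sqrt N * g) + auxF N (Real.tanh h) c (-(β / Real.sqrt N * g))
      ≤ 2 * N * h ^ 2 * (auxE β g * (3 * C1 ^ 2 + (3 + 2 * C1) * g ^ 2)) := by
  have hN1 : (1 : ℝ) ≤ N := by exact_mod_cast hN
  have hNpos : (0 : ℝ) < N := by linarith
  have hsN1 : 1 ≤ Real.sqrt N := Real.one_le_sqrt.2 hN1
  have hsN : 0 < Real.sqrt N := by linarith
  have hsq : Real.sqrt N ^ 2 = N := Real.sq_sqrt hNpos.le
  set t := Real.tanh h with ht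
  have ht0 : 0 ≤ t := aux_tanh_nonneg hh0
  have hth : t ≤ h := aux_tanh_le hh0
  have ht1 : t ≤ 1 := hth.trans hh1
  have htt : t ^ 2 ≤ h ^ 2 := pow_le_pow_left₀ ht0 hth 2
  have htt1 : t ^ 2 ≤ 1 := pow_le_one₀ ht0 ht1
  set x := β / Real.sqrt N * g with hx
  have hxx : x ^ 2 * N = β ^ 2 * g ^ 2 := by
    rw [hx, mul_pow, div_pow, hsq]; field_simp
  have hxa : |x| * Real.sqrt N = β * |g| := by
    rw [hx, abs_mul, abs_of_pos (div_pos hβ0 hsN)]; field_simp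
  set s := Real.sinh x with hs
  set C := Real.cosh x with hC
  have hCpos : 0 < C := Real.cosh_pos x
  have hCone : 1 ≤ C := Real.one_le_cosh x
  set L := C + t ^ 2 * |s| with hL
  have hCL : C ≤ L := by have : 0 ≤ t ^ 2 * |s| := by positivity
                         linarith
  have hL1 : 1 ≤ L := hCone.trans hCL
  have hL0 : 0 ≤ L := by linarith
  have hsC : |s| ≤ |x| * C := aux_abs_sinh_le x
  have hLexp : L ≤ Real.exp (x ^ 2 / 2 + t ^ 2 * |x|) := by
    calc L ≤ C + t ^ 2 * (|x| * C) := by rw [hL]; gcongr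
      _ = C * (t ^ 2 * |x| + 1) := by ring
      _ ≤ Real.exp (x ^ 2 / 2) * Real.exp (t ^ 2 * |x|) := by
          have := Real.add_one_le_exp (t ^ 2 * |x|)
          have := Real.cosh_le_exp_half_sq x
          gcongr
      _ = _ := by rw [Real.exp_add]
  set E := auxE β g with hE
  have hE0 : 0 < E := Real.exp_pos _
  have hLN : L ^ N ≤ E := by
    calc L ^ N ≤ Real.exp (x ^ 2 / 2 + t ^ 2 * |x|) ^ N := by gcongr
      _ = Real.exp (N * (x ^ 2 / 2 + t ^ 2 * |x|)) := by rw [← Real.exp_nat_mul]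
      _ ≤ E := by
          rw [hE, auxE]
          apply Real.exp_le_exp.2
          have e1 : N * (x ^ 2 / 2 + t ^ 2 * |x|)
              = x ^ 2 * N / 2 + (t ^ 2 * Real.sqrt N) * (|x| * Real.sqrt N) := by
            linear_combination (-(t ^ 2 * |x|)) * hsq
          rw [e1, hxx, hxa]
          have e2 : t ^ 2 * Real.sqrt N ≤ 1 :=
            (mul_le_mul_of_nonneg_right htt hsN.le).trans hhN
          have e3 : β * |g| ≤ |g| := mul_le_of_le_one_left (abs_nonneg g) hβ1.le
          have e4 : (t ^ 2 * Real.sqrt N) * (β * |g|) ≤ 1 * |g| := by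
            gcongr
          linarith
  have hNm : (0 : ℝ) ≤ (N : ℝ) - 1 := by linarith
  have hY : ((N : ℝ) - 1) * (s ^ 2 * L ^ (N - 2)) ≤ g ^ 2 * E := by
    rcases Nat.lt_or_ge N 2 with h2 | h2
    · have : N = 1 := by omega
      subst this
      simp; positivity
    · have e1 : s ^ 2 ≤ x ^ 2 * L ^ 2 := by
        calc s ^ 2 = |s| ^ 2 := (sq_abs s).symm
          _ ≤ (|x| * L) ^ 2 := by
            refine pow_le_pow_left₀ (abs_nonneg s) (hsC.trans ?_) 2
            gcongr
          _ = x ^ 2 * L ^ 2 := by rw [mul_pow, sq_abs]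
      calc ((N : ℝ) - 1) * (s ^ 2 * L ^ (N - 2)) ≤ N * ((x ^ 2 * L ^ 2) * L ^ (N - 2)) := by
            gcongr; linarith
        _ = (x ^ 2 * N) * L ^ N := by
            rw [mul_assoc (x ^ 2), ← pow_add, Nat.add_sub_cancel' h2]; ring
        _ ≤ (x ^ 2 * N) * E := by gcongr
        _ = β ^ 2 * g ^ 2 * E := by rw [hxx]
        _ ≤ 1 * g ^ 2 * E := by gcongr; exact pow_le_one₀ hβ0.le hβ1.le
        _ = g ^ 2 * E := by ring
  have hYL : ((N : ℝ) - 1) * (L ^ 2 * L ^ (N - 2)) ≤ N * E := by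
    rcases Nat.lt_or_ge N 2 with h2 | h2
    · have : N = 1 := by omega
      subst this
      simp; positivity
    · rw [← pow_add, Nat.add_sub_cancel' h2]
      gcongr; linarith
  have hYnn : 0 ≤ ((N : ℝ) - 1) * (s ^ 2 * L ^ (N - 2)) := by positivity
  have hYLnn : 0 ≤ ((N : ℝ) - 1) * (L ^ 2 * L ^ (N - 2)) := by positivity
  set d := c - t with hd
  have hd1 : |d| ≤ C1 := by
    refine hc.trans ?_
    have : h / Real.sqrt N ≤ 1 := by rw [div_le_one hsN]; linarith
    exact mul_le_of_le_one_right hC1 this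
  have hdN : d ^ 2 * N ≤ C1 ^ 2 * h ^ 2 := by
    calc d ^ 2 * N = |d| ^ 2 * N := by rw [sq_abs]
      _ ≤ (C1 * (h / Real.sqrt N)) ^ 2 * N := by gcongr
      _ = C1 ^ 2 * h ^ 2 := by rw [mul_pow, div_pow, hsq]; field_simp
  have hd2 : d ^ 2 ≤ C1 ^ 2 * h ^ 2 :=
    (le_mul_of_one_le_right (sq_nonneg d) hN1).trans hdN
  set κ := (1 - t ^ 2) * (1 - t ^ 2 - 2 * d * t) with hκ
  have hκ1 : |κ| ≤ 1 + 2 * C1 := by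
    rw [hκ, abs_mul, abs_of_nonneg (by linarith : 0 ≤ 1 - t ^ 2)]
    have e1 : |1 - t ^ 2 - 2 * d * t| ≤ 1 + 2 * C1 := by
      calc |1 - t ^ 2 - 2 * d * t| ≤ |1 - t ^ 2| + |2 * d * t| := abs_sub _ _
        _ = (1 - t ^ 2) + 2 * (|d| * t) := by
            rw [abs_of_nonneg (by linarith : 0 ≤ 1 - t ^ 2), abs_mul, abs_mul, abs_of_nonneg ht0]
            simp; ring
        _ ≤ 1 + 2 * (C1 * 1) := by
            gcongr; linarith [sq_nonneg t]
        _ = _ := by ring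
    calc (1 - t ^ 2) * |1 - t ^ 2 - 2 * d * t| ≤ 1 * |1 - t ^ 2 - 2 * d * t| := by
          gcongr; linarith [sq_nonneg t]
      _ ≤ _ := by linarith
  set Kp := auxK t x with hKp
  set Km := auxK t (-x) with hKm
  have hKpL : |Kp| ≤ L := by
    rw [hKp, auxK, hL]
    refine (abs_add_le _ _).trans ?_
    rw [abs_mul, abs_of_pos hCpos, abs_of_nonneg (sq_nonneg t)]
  have hKmL : |Km| ≤ L := by
    rw [hKm, auxK, hL, Real.cosh_neg, Real.sinh_neg]
    refine (abs_add_le _ _).trans ?_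
    rw [abs_mul, abs_of_pos hCpos, abs_of_nonneg (sq_nonneg t), abs_neg]
  have hdiff : Kp - Km = 2 * t ^ 2 * s := by
    rw [hKp, hKm, auxK, auxK, Real.cosh_neg, Real.sinh_neg]; ring
  have hT1 : κ * s * (Kp ^ (N - 1) - Km ^ (N - 1)) ≤ 2 * (1 + 2 * C1) * h ^ 2 * (g ^ 2 * E) := by
    have e0 := abs_pow_sub_pow_le Kp Km (N - 1)
    have e1 : max |Kp| |Km| ^ (N - 1 - 1) ≤ L ^ (N - 2) := by
      rw [Nat.sub_sub]
      exact pow_le_pow_left₀ (le_max_of_le_left (abs_nonneg _)) (max_le hKpL hKmL) _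
    have ecast : ((N - 1 : ℕ) : ℝ) = (N : ℝ) - 1 := by
      rw [Nat.cast_sub hN]; simp
    rw [ecast, hdiff] at e0
    calc κ * s * (Kp ^ (N - 1) - Km ^ (N - 1))
        ≤ |κ * s * (Kp ^ (N - 1) - Km ^ (N - 1))| := le_abs_self _
      _ = |κ| * |s| * |Kp ^ (N - 1) - Km ^ (N - 1)| := by rw [abs_mul, abs_mul]
      _ ≤ (1 + 2 * C1) * |s| * (|2 * t ^ 2 * s| * ((N : ℝ) - 1) * L ^ (N - 2)) := by
          gcongr
          refine e0.trans ?_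
          gcongr
      _ = 2 * (1 + 2 * C1) * t ^ 2 * (((N : ℝ) - 1) * (s ^ 2 * L ^ (N - 2))) := by
          rw [abs_mul, abs_of_nonneg (by positivity : 0 ≤ 2 * t ^ 2), ← sq_abs s]; ring
      _ ≤ 2 * (1 + 2 * C1) * h ^ 2 * (g ^ 2 * E) := by gcongr
  have hT2 : ∀ K : ℝ, |K| ≤ L → K ^ (N - 1) * (d ^ 2 * K) ≤ C1 ^ 2 * h ^ 2 * E := by
    intro K hK
    have e1 : K ^ (N - 1) * K ≤ E := by
      rw [← pow_succ, Nat.sub_add_cancel hN]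
      calc K ^ N ≤ |K ^ N| := le_abs_self _
        _ = |K| ^ N := abs_pow _ _
        _ ≤ L ^ N := by gcongr
        _ ≤ E := hLN
    calc K ^ (N - 1) * (d ^ 2 * K) = d ^ 2 * (K ^ (N - 1) * K) := by ring
      _ ≤ d ^ 2 * E := by gcongr
      _ ≤ _ := by gcongr
  have hT3 : ∀ K sv : ℝ, |K| ≤ L → sv ^ 2 = s ^ 2 →
      ((N : ℝ) - 1) * K ^ (N - 2) * (t * (1 - t ^ 2) * sv - d * K) ^ 2
        ≤ 2 * h ^ 2 * (g ^ 2 * E) + 2 * (C1 ^ 2 * h ^ 2) * E := by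
    intro K sv hK hsv
    have e1 : K ^ (N - 2) ≤ L ^ (N - 2) := by
      calc K ^ (N - 2) ≤ |K ^ (N - 2)| := le_abs_self _
        _ = |K| ^ (N - 2) := abs_pow _ _
        _ ≤ _ := by gcongr
    have e2 : (t * (1 - t ^ 2)) ^ 2 ≤ h ^ 2 := by
      refine pow_le_pow_left₀ (mul_nonneg ht0 (by linarith)) ?_ 2
      exact (mul_le_of_le_one_right ht0 (by linarith [sq_nonneg t])).trans hth
    have e3 : K ^ 2 ≤ L ^ 2 := by
      rw [← sq_abs K]; gcongr
    have e4 : (t * (1 - t ^ 2) * sv - d * K) ^ 2 ≤ 2 * h ^ 2 * s ^ 2 + 2 * d ^ 2 * L ^ 2 := by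
      calc (t * (1 - t ^ 2) * sv - d * K) ^ 2
          ≤ 2 * ((t * (1 - t ^ 2)) ^ 2 * sv ^ 2) + 2 * (d ^ 2 * K ^ 2) := by
            exact aux_sq_sub_le _ _ _ _
        _ ≤ 2 * (h ^ 2 * s ^ 2) + 2 * (d ^ 2 * L ^ 2) := by
            rw [hsv]; gcongr
        _ = _ := by ring
    calc ((N : ℝ) - 1) * K ^ (N - 2) * (t * (1 - t ^ 2) * sv - d * K) ^ 2
        ≤ ((N : ℝ) - 1) * L ^ (N - 2) * (2 * h ^ 2 * s ^ 2 + 2 * d ^ 2 * L ^ 2) := by gcongr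
      _ = 2 * h ^ 2 * (((N : ℝ) - 1) * (s ^ 2 * L ^ (N - 2)))
          + 2 * d ^ 2 * (((N : ℝ) - 1) * (L ^ 2 * L ^ (N - 2))) := by ring
      _ ≤ 2 * h ^ 2 * (g ^ 2 * E) + 2 * d ^ 2 * (N * E) := by gcongr
      _ = 2 * h ^ 2 * (g ^ 2 * E) + 2 * (d ^ 2 * N) * E := by ring
      _ ≤ _ := by gcongr
  have f2p := hT2 Kp hKpL
  have f2m := hT2 Km hKmL
  have f3p := hT3 Kp s hKpL rfl
  have f3m := hT3 Km (-s) hKmL (by ring)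
  have hsum : auxF N t c x + auxF N t c (-x)
      = N * (κ * s * (Kp ^ (N - 1) - Km ^ (N - 1)) + Kp ^ (N - 1) * (d ^ 2 * Kp)
          + Km ^ (N - 1) * (d ^ 2 * Km)
          + ((N : ℝ) - 1) * Kp ^ (N - 2) * (t * (1 - t ^ 2) * s - d * Kp) ^ 2
          + ((N : ℝ) - 1) * Km ^ (N - 2) * (t * (1 - t ^ 2) * (-s) - d * Km) ^ 2) := by
    rw [auxF, auxF, Real.sinh_neg]; ring
  rw [hsum]
  calc _ ≤ N * (2 * (1 + 2 * C1) * h ^ 2 * (g ^ 2 * E) + C1 ^ 2 * h ^ 2 * E + C1 ^ 2 * h ^ 2 * E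
        + (2 * h ^ 2 * (g ^ 2 * E) + 2 * (C1 ^ 2 * h ^ 2) * E)
        + (2 * h ^ 2 * (g ^ 2 * E) + 2 * (C1 ^ 2 * h ^ 2) * E)) := by gcongr
    _ = _ := by ring

/-! ### Assembly -/

lemma aux_skWeight {N : ℕ} (W : Matrix (Fin N) (Fin N) ℝ) (β h : ℝ) (σ : Fin N → Bool) :
    skWeight W β h σ = (2 * Real.cosh h) ^ N * (∏ i, auxP (Real.tanh h) (σ i)) *
      auxQ β (fun i j => spin (σ i) * spin (σ j)) W := by
  rw [skWeight, Real.exp_add, aux_exp_sum_spin, auxQ, mul_comm]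
  simp only [mul_assoc]

lemma auxQ_mul {N : ℕ} (β : ℝ) (u v : Fin N → Fin N → ℝ) (W : Matrix (Fin N) (Fin N) ℝ) :
    auxQ β u W * auxQ β v W = auxQ β (fun i j => u i j + v i j) W := by
  simp only [auxQ]
  rw [← Real.exp_add, ← mul_add, ← Finset.sum_add_distrib]
  simp only [← Finset.sum_add_distrib, mul_add]

lemma aux_spin_sq (b : Bool) : spin b * spin b = 1 := by cases b <;> simp [spin]

lemma aux_skZ_pos {N : ℕ} (W : Matrix (Fin N) (Fin N) ℝ) (β h : ℝ) : 0 < skZ W β h :=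
  Finset.sum_pos (fun _ _ => Real.exp_pos _) Finset.univ_nonempty

lemma aux_meanMag {N : ℕ} (hN : 1 ≤ N) (W : Matrix (Fin N) (Fin N) ℝ) (β h c : ℝ) :
    skZ W β h * (meanMag W β h - c)
      = (1 / (N : ℝ)) * ∑ σ : Fin N → Bool, skWeight W β h σ * ∑ i, (spin (σ i) - c) := by
  have hZ := aux_skZ_pos W β h
  have hNpos : (0 : ℝ) < N := by exact_mod_cast hN
  have hint : ∀ i : Fin N, ∫ σ, spin (σ i) ∂skGibbs W β h
      = ∑ σ : Fin N → Bool, skDensity W β h σ * spin (σ i) := by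
    intro i
    unfold skGibbs
    rw [integral_finsetSum_measure]
    · refine Finset.sum_congr rfl fun σ _ => ?_
      rw [integral_smul_measure, integral_dirac, smul_eq_mul, ENNReal.toReal_ofReal]
      exact div_nonneg (Real.exp_pos _).le hZ.le
    · intro σ _
      refine Integrable.smul_measure ?_ ENNReal.ofReal_ne_top
      exact Integrable.of_finite
  have h1 : skZ W β h * ∑ i : Fin N, ∫ σ, spin (σ i) ∂skGibbs W β h
      = ∑ σ : Fin N → Bool, skWeight W β h σ * ∑ i, spin (σ i) := by
    simp_rw [hint]
    rw [Finset.sum_comm, Finset.mul_sum]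
    refine Finset.sum_congr rfl fun σ _ => ?_
    rw [← Finset.mul_sum, skDensity]
    field_simp
  have h2 : ∑ σ : Fin N → Bool, skWeight W β h σ * ∑ i, (spin (σ i) - c)
      = (∑ σ : Fin N → Bool, skWeight W β h σ * ∑ i, spin (σ i)) - skZ W β h * (N * c) := by
    rw [skZ, Finset.sum_mul, ← Finset.sum_sub_distrib]
    refine Finset.sum_congr rfl fun σ _ => ?_
    rw [Finset.sum_sub_distrib]
    simp
    ring
  rw [h2, ← h1, meanMag]
  field_simp

lemma aux_EZ {N : ℕ} (hN : 1 ≤ N) (β h : ℝ) :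
    ∫ W, skZ W β h ∂GOE N = (2 * Real.cosh h) ^ N * Real.exp (β ^ 2 * N / 4) := by
  have hNpos : (0 : ℝ) < N := by exact_mod_cast hN
  have hsym : ∀ σ : Fin N → Bool, ∀ i j, spin (σ i) * spin (σ j) = spin (σ j) * spin (σ i) :=
    fun σ i j => mul_comm _ _
  simp only [skZ, aux_skWeight]
  rw [integral_finsetSum _ fun σ _ => (aux_integrable_Q β _ (hsym σ)).const_mul _]
  simp_rw [integral_const_mul]
  have e : ∀ σ : Fin N → Bool,
      ∫ W, auxQ β (fun i j => spin (σ i) * spin (σ j)) W ∂GOE N = Real.exp (β ^ 2 * N / 4) := by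
    intro σ
    rw [aux_integral_Q β _ (hsym σ)]
    congr 1
    have : ∀ i j, (spin (σ i) * spin (σ j)) ^ 2 = 1 := by
      intro i j
      linear_combination (spin (σ j) * spin (σ j)) * aux_spin_sq (σ i) + aux_spin_sq (σ j)
    simp_rw [this]
    simp
    field_simp
  simp_rw [e]
  rw [← Finset.sum_mul, ← Finset.mul_sum, aux_S0]
  have e1 : ∑ b, auxP (Real.tanh h) b = 1 := by
    simp [auxP, spin]
    ring
  rw [e1]
  simp

lemma aux_pairQ {N : ℕ} (hN : 1 ≤ N) (β : ℝ) (σ ρ : Fin N → Bool) :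
    ∫ W, auxQ β (fun i j => spin (σ i) * spin (σ j) + spin (ρ i) * spin (ρ j)) W ∂GOE N
      = Real.exp (β ^ 2 * N / 4) ^ 2 *
        ∫ g, Real.exp (β / Real.sqrt N * g * ∑ i, spin (σ i) * spin (ρ i)) ∂_root_.stdGaussian := by
  have hNpos : (0 : ℝ) < N := by exact_mod_cast hN
  have hsq : Real.sqrt N ^ 2 = N := Real.sq_sqrt hNpos.le
  rw [aux_integral_Q β _ (fun i j => by ring)]
  set T := ∑ i, spin (σ i) * spin (ρ i) with hT
  have e1 : ∀ g : ℝ, β / Real.sqrt N * g * T = (β / Real.sqrt N * T) * g := by intro g; ring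
  simp_rw [e1, _root_.stdGaussian]
  rw [aux_integral_exp, ← Real.exp_nat_mul, ← Real.exp_add]
  congr 1
  have e2 : ∀ i j, (spin (σ i) * spin (σ j) + spin (ρ i) * spin (ρ j)) ^ 2
      = 2 + 2 * ((spin (σ i) * spin (ρ i)) * (spin (σ j) * spin (ρ j))) := by
    intro i j
    linear_combination (spin (σ j) * spin (σ j)) * aux_spin_sq (σ i) + aux_spin_sq (σ j)
      + (spin (ρ j) * spin (ρ j)) * aux_spin_sq (ρ i) + aux_spin_sq (ρ j)
  have e3 : ∑ i, ∑ j, (spin (σ i) * spin (σ j) + spin (ρ i) * spin (ρ j)) ^ 2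
      = 2 * N ^ 2 + 2 * T ^ 2 := by
    simp_rw [e2, Finset.sum_add_distrib, ← Finset.mul_sum, ← Finset.sum_mul, ← hT]
    simp
    ring
  rw [e3, mul_pow, div_pow, hsq]
  simp
  field_simp
  ring

lemma aux_integrable_term (N : ℕ) (β T : ℝ) :
    Integrable (fun g => Real.exp (β / Real.sqrt N * g * T)) _root_.stdGaussian := by
  have e1 : ∀ g : ℝ, β / Real.sqrt N * g * T = (β / Real.sqrt N * T) * g := by intro g; ring
  simp_rw [e1, _root_.stdGaussian]
  exact integrable_exp_mul_gaussianReal _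

lemma aux_integrable_F (N : ℕ) (β t c : ℝ) :
    Integrable (fun g => auxF N t c (β / Real.sqrt N * g)) _root_.stdGaussian := by
  simp_rw [← aux_pair_sum]
  exact integrable_finsetSum _ fun σ _ => integrable_finsetSum _ fun ρ _ =>
    (aux_integrable_term N β _).const_mul _

lemma aux_lhs {N : ℕ} (hN : 1 ≤ N) (β h c : ℝ) :
    ∫ W, (skZ W β h) ^ 2 * (meanMag W β h - c) ^ 2 ∂GOE N
      = (∫ W, skZ W β h ∂GOE N) ^ 2 * ((1 / (N : ℝ)) ^ 2 *
        ∫ g, auxF N (Real.tanh h) c (β / Real.sqrt N * g) ∂_root_.stdGaussian) := by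
  have hfun : ∀ W : Matrix (Fin N) (Fin N) ℝ, (skZ W β h) ^ 2 * (meanMag W β h - c) ^ 2
      = ∑ σ : Fin N → Bool, ∑ ρ : Fin N → Bool, ((1 / (N : ℝ)) ^ 2 * ((2 * Real.cosh h) ^ N) ^ 2 *
        ((∏ i, auxP (Real.tanh h) (σ i)) * (∏ i, auxP (Real.tanh h) (ρ i)) *
        ((∑ i, (spin (σ i) - c)) * ∑ i, (spin (ρ i) - c)))) *
        auxQ β (fun i j => spin (σ i) * spin (σ j) + spin (ρ i) * spin (ρ j)) W := by
    intro W
    rw [← mul_pow, aux_meanMag hN, mul_pow, sq (∑ σ : Fin N → Bool, _), Finset.sum_mul_sum,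
      Finset.mul_sum]
    refine Finset.sum_congr rfl fun σ _ => ?_
    rw [Finset.mul_sum]
    refine Finset.sum_congr rfl fun ρ _ => ?_
    rw [← auxQ_mul β (fun i j => spin (σ i) * spin (σ j)) (fun i j => spin (ρ i) * spin (ρ j)),
      aux_skWeight, aux_skWeight]
    ring
  have hsym : ∀ σ ρ : Fin N → Bool, ∀ i j, spin (σ i) * spin (σ j) + spin (ρ i) * spin (ρ j)
      = spin (σ j) * spin (σ i) + spin (ρ j) * spin (ρ i) := fun σ ρ i j => by ring
  simp_rw [hfun]
  rw [integral_finsetSum _ fun σ _ => integrable_finsetSum _ fun ρ _ =>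
    (aux_integrable_Q β _ (hsym σ ρ)).const_mul _]
  simp_rw [integral_finsetSum _ fun ρ _ => (aux_integrable_Q β _ (hsym _ ρ)).const_mul _,
    integral_const_mul, aux_pairQ hN]
  simp_rw [← aux_pair_sum]
  rw [integral_finsetSum _ fun σ _ => integrable_finsetSum _ fun ρ _ =>
    (aux_integrable_term N β _).const_mul _, aux_EZ hN, Finset.mul_sum, Finset.mul_sum]
  refine Finset.sum_congr rfl fun σ _ => ?_
  rw [integral_finsetSum _ fun ρ _ => (aux_integrable_term N β _).const_mul _,
    Finset.mul_sum, Finset.mul_sum]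
  refine Finset.sum_congr rfl fun ρ _ => ?_
  rw [integral_const_mul]
  ring

lemma aux_integral_neg (f : ℝ → ℝ) (hf : Integrable f _root_.stdGaussian) :
    Integrable (fun g => f (-g)) _root_.stdGaussian ∧
    ∫ g, f (-g) ∂_root_.stdGaussian = ∫ g, f g ∂_root_.stdGaussian := by
  have hmap : Measure.map (fun x : ℝ => -x) _root_.stdGaussian = _root_.stdGaussian := by
    unfold _root_.stdGaussian
    rw [gaussianReal_map_neg, neg_zero]
  have hmp : MeasurePreserving (fun x : ℝ => -x) _root_.stdGaussian _root_.stdGaussian :=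
    ⟨measurable_neg, hmap⟩
  exact ⟨hmp.integrable_comp_of_integrable hf,
    hmp.integral_comp (MeasurableEquiv.neg ℝ).measurableEmbedding f⟩


/-- Second moment estimate with the partition function: for `β ∈ (0,1)` and
`α > 1/4`, there is `C = C(β,α)` such that for all `N ≥ 1` and `0 ≤ h ≤ N^{−α}`,
`E_W[Z(W)² (m_W(h) − q₁(β,h))²] ≤ C (E_W Z(W))² max{1/N, h/√N}²`. -/
theorem stmt8 (β α : ℝ) (hβ0 : 0 < β) (hβ1 : β < 1) (hα : 1 / 4 < α) :
    ∃ C : ℝ, 0 < C ∧ ∀ N : ℕ, 1 ≤ N → ∀ h : ℝ, 0 ≤ h → h ≤ (N : ℝ) ^ (-α) →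
      (∫ W, (skZ W β h) ^ 2 * (meanMag W β h - q1 β h) ^ 2 ∂GOE N)
        ≤ C * (∫ W, skZ W β h ∂GOE N) ^ 2 * max (1 / (N : ℝ)) (h / Real.sqrt N) ^ 2 := by
  obtain ⟨C1, hC1, hq1⟩ := aux_q1_bound hβ0 hβ1
  set M := ∫ g, auxE β g * (3 * C1 ^ 2 + (3 + 2 * C1) * g ^ 2) ∂_root_.stdGaussian with hM
  have hMint := aux_integrable_E hβ0 hβ1 (3 * C1 ^ 2) (3 + 2 * C1)
  have hMnn : 0 ≤ M := integral_nonneg fun g =>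
    mul_nonneg (Real.exp_pos _).le (by positivity)
  refine ⟨M + 1, by linarith, fun N hN h hh0 hhN => ?_⟩
  have hN1 : (1 : ℝ) ≤ N := by exact_mod_cast hN
  have hNpos : (0 : ℝ) < N := by linarith
  have hsN1 : 1 ≤ Real.sqrt N := Real.one_le_sqrt.2 hN1
  have hsN : 0 < Real.sqrt N := by linarith
  have hsq : Real.sqrt N ^ 2 = N := Real.sq_sqrt hNpos.le
  have hh1 : h ≤ 1 := hhN.trans (Real.rpow_le_one_of_one_le_of_nonpos hN1 (by linarith))
  have hhsq : h ^ 2 * Real.sqrt N ≤ 1 := by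
    have h1 : h ≤ (N : ℝ) ^ (-(1 / 4) : ℝ) :=
      hhN.trans (Real.rpow_le_rpow_of_exponent_le hN1 (by linarith))
    have h2 : h ^ 2 ≤ ((N : ℝ) ^ (-(1 / 4) : ℝ)) ^ 2 := pow_le_pow_left₀ hh0 h1 2
    calc h ^ 2 * Real.sqrt N ≤ ((N : ℝ) ^ (-(1 / 4) : ℝ)) ^ 2 * Real.sqrt N := by gcongr
      _ = 1 := by
        rw [Real.sqrt_eq_rpow, ← Real.rpow_natCast, ← Real.rpow_mul hNpos.le,
          ← Real.rpow_add hNpos]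
        norm_num
  have hc : |q1 β h - Real.tanh h| ≤ C1 * (h / Real.sqrt N) := by
    refine (hq1 h hh0).trans (mul_le_mul_of_nonneg_left ?_ hC1.le)
    rw [le_div_iff₀ hsN]
    calc h ^ 3 * Real.sqrt N = h * (h ^ 2 * Real.sqrt N) := by ring
      _ ≤ h * 1 := by gcongr
      _ = h := mul_one h
  have hFi := aux_integrable_F N β (Real.tanh h) (q1 β h)
  obtain ⟨hFn, hFe⟩ := aux_integral_neg _ hFi
  simp only [mul_neg] at hFn hFe
  have hF : ∫ g, auxF N (Real.tanh h) (q1 β h) (β / Real.sqrt N * g) ∂_root_.stdGaussian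
      ≤ N * h ^ 2 * M := by
    have h1 := integral_mono (hFi.add hFn) (hMint.const_mul (2 * N * h ^ 2))
      (fun g => aux_pointwise hβ0 hβ1 hN hh0 hh1 hhsq hC1.le hc)
    rw [integral_const_mul] at h1
    simp only [Pi.add_apply] at h1
    rw [integral_add hFi hFn, hFe] at h1
    linarith
  rw [aux_lhs hN]
  set Z := (∫ W, skZ W β h ∂GOE N) ^ 2 with hZ
  have hZ0 : 0 ≤ Z := sq_nonneg _
  have hmax : h ^ 2 / N ≤ max (1 / (N : ℝ)) (h / Real.sqrt N) ^ 2 := by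
    calc h ^ 2 / N = (h / Real.sqrt N) ^ 2 := by rw [div_pow, hsq]
      _ ≤ _ := pow_le_pow_left₀ (by positivity) (le_max_right _ _) 2
  calc Z * ((1 / (N : ℝ)) ^ 2 *
        ∫ g, auxF N (Real.tanh h) (q1 β h) (β / Real.sqrt N * g) ∂_root_.stdGaussian)
      ≤ Z * ((1 / (N : ℝ)) ^ 2 * (N * h ^ 2 * M)) := by gcongr
    _ = M * Z * (h ^ 2 / N) := by field_simp
    _ ≤ (M + 1) * Z * max (1 / (N : ℝ)) (h / Real.sqrt N) ^ 2 := by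
        gcongr
        linarith
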